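/- Let Ω ⊂ ℝ^d be a polyhedral Lipschitz domain with a regular, κ-shape-regular simplicial mesh T_h. For every discrete harmonic function ψ_h ∈ S̃^1(T_h) it holds ‖Eγψ_h − ψ_h‖_{L_2(Ω)} ≤ ‖∇(Eγψ_h − ψ_h)‖_{L_2(Ω)} · sup_{‖f‖_{L_2(Ω)}=1} inf_{v_h ∈ S^1_0(T_h)} ‖v_f − v_h‖_{H^1(Ω)}, where for f ∈ L_2(Ω), v_f ∈ H^1_0(Ω) denotes the weak solution of −Δv_f = f in Ω with v_f = 0 on Γ. -/

import Mathlib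

open Function
open scoped RealInnerProductSpace

/-- Abstract model: `Ω ⊆ ℝ^d` is a bounded polyhedral (Lipschitz) domain; `H1` plays
the role of `H¹(Ω)`, `L2` of `L²(Ω)`, `G` of `L²(Ω)^d` (target of the weak
gradient `grad`), `T` of the trace space `H^{1/2}(Γ)`; `tr` is the trace map `γ`,
so `H¹₀(Ω) = ker tr`.  `E : T → H1` is the harmonic extension operator.
`S1` is the (finite-dimensional) space `S¹(T_h)` of continuous piecewise
polynomials on a regular, `κ`-shape-regular simplicial mesh `T_h`,
`S¹₀(T_h) = {v ∈ S¹(T_h) : γ v = 0}`, and `S̃¹(T_h)` is the set of discrete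
harmonic functions of `S¹(T_h)`.  For `f ∈ L²(Ω)`, `vsol f ∈ H¹₀(Ω)` is the weak
solution of `−Δ v_f = f` in `Ω`, `v_f = 0` on `Γ`.

Claim (Aubin–Nitsche-type estimate): for every `ψ_h ∈ S̃¹(T_h)` it holds that
`‖E γψ_h − ψ_h‖_{L²(Ω)} ≤ ‖∇(E γψ_h − ψ_h)‖_{L²(Ω)} ⋅
  sup_{‖f‖_{L²(Ω)}=1} inf_{v_h ∈ S¹₀(T_h)} ‖v_f − v_h‖_{H¹(Ω)}`. -/
theorem statement11
    {d : ℕ} (Ω : Set (EuclideanSpace ℝ (Fin d)))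
    (hΩo : IsOpen Ω) (hΩb : Bornology.IsBounded Ω) (hΩne : Ω.Nonempty)
    {H1 L2 G T : Type*}
    [NormedAddCommGroup H1] [InnerProductSpace ℝ H1] [CompleteSpace H1]
    [NormedAddCommGroup L2] [InnerProductSpace ℝ L2] [CompleteSpace L2]
    [NormedAddCommGroup G] [InnerProductSpace ℝ G] [CompleteSpace G]
    [NormedAddCommGroup T] [NormedSpace ℝ T]
    (ι : H1 →L[ℝ] L2) (hι : Injective ι)
    (grad : H1 →L[ℝ] G)
    (tr : H1 →L[ℝ] T) (htr : Surjective tr)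
    (hnorm : ∀ v : H1, ‖v‖ ^ 2 = ‖ι v‖ ^ 2 + ‖grad v‖ ^ 2)
    (E : T → H1)
    (hEtr : ∀ q : T, tr (E q) = q)
    (hEharm : ∀ (q : T) (v : H1), tr v = 0 → ⟪grad (E q), grad v⟫ = 0)
    (vsol : L2 →L[ℝ] H1)
    (hvsol : ∀ f : L2, tr (vsol f) = 0 ∧
      ∀ w : H1, tr w = 0 → ⟪grad (vsol f), grad w⟫ = ⟪f, ι w⟫)
    (S1 : Submodule ℝ H1) (hfd : FiniteDimensional ℝ S1)
    (St1 : Set H1)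
    (hSt1 : St1 = {u ∈ (S1 : Set H1) |
        ∀ v ∈ (S1 : Set H1), tr v = 0 → ⟪grad u, grad v⟫ = 0}) :
    ∀ ψh ∈ St1,
      ‖ι (E (tr ψh)) - ι ψh‖
        ≤ ‖grad (E (tr ψh)) - grad ψh‖ *
          sSup {s : ℝ | ∃ f : L2, ‖f‖ = 1 ∧
            s = sInf ((fun vh : H1 => ‖vsol f - vh‖) ''
              {v ∈ (S1 : Set H1) | tr v = 0})} := by
  subst hSt1
  rintro ψh ⟨hψS, hψharm⟩
  rw [← map_sub, ← map_sub]
  set e : H1 := E (tr ψh) - ψh with he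
  have hetr : tr e = 0 := by rw [he, map_sub, hEtr, sub_self]
  have horth : ∀ v ∈ S1, tr v = 0 → ⟪grad v, grad e⟫ = 0 := by
    intro v hv htv
    rw [real_inner_comm, he, map_sub, inner_sub_left, hEharm _ v htv, hψharm v hv htv, sub_zero]
  have hgrad_le : ∀ v : H1, ‖grad v‖ ≤ ‖v‖ := fun v =>
    le_of_sq_le_sq (by rw [hnorm v]; exact le_add_of_nonneg_left (sq_nonneg _)) (norm_nonneg v)
  set dist₀ : L2 → Set ℝ := fun f =>
    (fun vh : H1 => ‖vsol f - vh‖) '' {v ∈ (S1 : Set H1) | tr v = 0}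
  have hzero : ∀ f, ‖vsol f‖ ∈ dist₀ f := fun f => ⟨0, ⟨S1.zero_mem, map_zero tr⟩, by simp⟩
  have hnonneg : ∀ f, ∀ r ∈ dist₀ f, 0 ≤ r := by
    rintro f _ ⟨v, -, rfl⟩
    exact norm_nonneg _
  have hbdd : BddAbove {s : ℝ | ∃ f : L2, ‖f‖ = 1 ∧ s = sInf (dist₀ f)} := by
    refine ⟨‖vsol‖, ?_⟩
    rintro _ ⟨f, hf, rfl⟩
    calc sInf (dist₀ f) ≤ ‖vsol f‖ := csInf_le ⟨0, hnonneg f⟩ (hzero f)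
      _ ≤ ‖vsol‖ := by simpa [hf] using vsol.le_opNorm f
  rcases eq_or_ne (ι e) 0 with h0 | h0
  · rw [h0, norm_zero]
    refine mul_nonneg (norm_nonneg _) (Real.sSup_nonneg ?_)
    rintro _ ⟨f, -, rfl⟩
    exact Real.sInf_nonneg (hnonneg f)
  · have hpos : 0 < ‖ι e‖ := norm_pos_iff.2 h0
    set f : L2 := ‖ι e‖⁻¹ • ι e with hf
    have hf1 : ‖f‖ = 1 := norm_smul_inv_norm h0
    have hfe : ⟪f, ι e⟫ = ‖ι e‖ := by
      rw [hf, real_inner_smul_left, real_inner_self_eq_norm_sq]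
      field_simp
    have hle : ∀ r ∈ dist₀ f, ‖ι e‖ ≤ ‖grad e‖ * r := by
      rintro _ ⟨v, ⟨hv, htv⟩, rfl⟩
      calc ‖ι e‖ = ⟪grad (vsol f - v), grad e⟫ := by
            rw [map_sub grad, inner_sub_left, horth v hv htv, sub_zero, (hvsol f).2 e hetr, hfe]
        _ ≤ ‖grad (vsol f - v)‖ * ‖grad e‖ := real_inner_le_norm _ _
        _ ≤ ‖vsol f - v‖ * ‖grad e‖ := by gcongr; exact hgrad_le _
        _ = ‖grad e‖ * ‖vsol f - v‖ := mul_comm _ _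
    have hgpos : 0 < ‖grad e‖ :=
      pos_of_mul_pos_left (hpos.trans_le (hle _ (hzero f))) (norm_nonneg _)
    calc ‖ι e‖ ≤ ‖grad e‖ * sInf (dist₀ f) := by
          rw [← div_le_iff₀' hgpos]
          exact le_csInf ⟨_, hzero f⟩ fun r hr => (div_le_iff₀' hgpos).2 (hle r hr)
      _ ≤ _ := mul_le_mul_of_nonneg_left (le_csSup hbdd ⟨f, hf1, rfl⟩) (norm_nonneg _)
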